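/- Let V be a finite vertex type and G a simple graph on V that admits a rectangular dual ρ. Then there exists a scaling ρ' of ρ (a rectangular dual of the same graph G in which every adjacency keeps its type, vertical or horizontal) such that G and ρ' admit a straight-line simultaneous drawing, i.e. there is an injective placement φ : V → ℝ² with φ(v) in the interior of ρ'(v) for every vertex v, such that (a) for every edge uv of G the closed segment from φ(u) to φ(v) meets the union of the boundaries of all the rectangles ρ'(w), w ∈ V, in exactly one point, and this point lies in the relative interior of the common segment ρ'(u) ∩ ρ'(v), and (b) the straight-line drawing is planar: for any two distinct edges e, f of G, the segments representing e and f intersect at most in the image under φ of a common endpoint of e and f. -/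

import Mathlib

open Set

/-- An axis-aligned rectangle: a product `[x₁,x₂] × [y₁,y₂]` with `x₁ < x₂` and `y₁ < y₂`. -/
def IsRect (s : Set (ℝ × ℝ)) : Prop :=
  ∃ x₁ x₂ y₁ y₂ : ℝ, x₁ < x₂ ∧ y₁ < y₂ ∧ s = Icc x₁ x₂ ×ˢ Icc y₁ y₂

/-- A set contains at least two distinct points (a segment of positive length, for
intersections of adjacent rectangles). -/
def HasTwoPoints (s : Set (ℝ × ℝ)) : Prop :=
  ∃ p q : ℝ × ℝ, p ≠ q ∧ p ∈ s ∧ q ∈ s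

/-- The common segment is contained in a vertical line (vertical adjacency). -/
def IsVerticalSeg (s : Set (ℝ × ℝ)) : Prop :=
  ∃ x : ℝ, ∀ p ∈ s, p.1 = x

/-- `ρ` is a rectangular dual of the simple graph `G`. -/
structure IsRectangularDual {V : Type*} [Fintype V] (G : SimpleGraph V)
    (ρ : V → Set (ℝ × ℝ)) : Prop where
  /-- every vertex is assigned an axis-aligned rectangle -/
  rect : ∀ v, IsRect (ρ v)
  /-- the interiors of the rectangles are pairwise disjoint -/
  disjoint_interiors : ∀ u v : V, u ≠ v → interior (ρ u) ∩ interior (ρ v) = ∅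
  /-- the union of all the rectangles is itself a rectangle -/
  union_rect : IsRect (⋃ v, ρ v)
  /-- no point belongs to four or more of the rectangles -/
  no_four_meet : ∀ p : ℝ × ℝ, {v : V | p ∈ ρ v}.ncard ≤ 3
  /-- two distinct vertices are adjacent iff their rectangles share a boundary
  segment of positive length -/
  adj_iff : ∀ u v : V, u ≠ v → (G.Adj u v ↔ HasTwoPoints (ρ u ∩ ρ v))

/-- `ρ'` is a scaling of `ρ`: a rectangular dual of the same graph in which every
adjacency keeps its type (vertical or horizontal). -/
def IsScaling {V : Type*} [Fintype V] (G : SimpleGraph V)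
    (ρ ρ' : V → Set (ℝ × ℝ)) : Prop :=
  IsRectangularDual G ρ' ∧
    ∀ u v : V, G.Adj u v →
      (IsVerticalSeg (ρ' u ∩ ρ' v) ↔ IsVerticalSeg (ρ u ∩ ρ v))

/-- `G` and the rectangular dual `ρ` admit a straight-line simultaneous drawing. -/
def HasStraightLineSimultaneousDrawing {V : Type*} [Fintype V] (G : SimpleGraph V)
    (ρ : V → Set (ℝ × ℝ)) : Prop :=
  ∃ φ : V → ℝ × ℝ,
    Function.Injective φ ∧
    (∀ v : V, φ v ∈ interior (ρ v)) ∧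
    -- (a) each edge crosses the union of the rectangle boundaries in exactly one
    -- point, lying in the relative interior of the common segment
    (∀ u v : V, G.Adj u v → ∃ z : ℝ × ℝ,
      segment ℝ (φ u) (φ v) ∩ (⋃ w : V, frontier (ρ w)) = {z} ∧
      z ∈ intrinsicInterior ℝ (ρ u ∩ ρ v)) ∧
    -- (b) planarity: two distinct edges meet at most in the image of a common endpoint
    (∀ u v a b : V, G.Adj u v → G.Adj a b → s(u, v) ≠ s(a, b) →
      segment ℝ (φ u) (φ v) ∩ segment ℝ (φ a) (φ b) ⊆
        φ '' (({u, v} : Set V) ∩ ({a, b} : Set V)))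


/-- Abstract tiling data: `e v false`, `e v true` are the left and right side of `v`. -/
structure Tl (V : Type*) where
  e : V → Bool → ℝ
  b : V → ℝ
  t : V → ℝ
  X0 : ℝ
  X1 : ℝ
  Y0 : ℝ
  Y1 : ℝ
  X01 : X0 < X1
  Y01 : Y0 < Y1
  lr : ∀ v, e v false < e v true
  bt : ∀ v, b v < t v
  disj : ∀ u v, u ≠ v → e u false < e v true → e v false < e u true → b u < t v → b v < t u → False
  inl : ∀ v, X0 ≤ e v false
  inr : ∀ v, e v true ≤ X1
  inb : ∀ v, Y0 ≤ b v
  intop : ∀ v, t v ≤ Y1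
  cover : ∀ p q, X0 ≤ p → p ≤ X1 → Y0 ≤ q → q ≤ Y1 →
    ∃ v, e v false ≤ p ∧ p ≤ e v true ∧ b v ≤ q ∧ q ≤ t v

/-- The invariant of the level-by-level construction, for the set `s` of processed levels. -/
structure Good {V : Type*} (T : Tl V) (s : Finset ℝ) (Y : ℝ → ℝ) (e' : V → Bool → ℝ)
    (x y : V → ℝ) : Prop where
  Ym : ∀ c ∈ s, ∀ d ∈ s, c < d → Y c < Y d
  ylo : ∀ u, T.b u ∈ s → Y (T.b u) < y u
  yhi : ∀ u, T.b u ∈ s → ∀ c ∈ s, T.b u < c → y u < Y c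
  xlo : ∀ u, T.b u ∈ s → e' u false < x u
  xhi : ∀ u, T.b u ∈ s → x u < e' u true
  bd0 : ∀ u i, T.b u ∈ s → 0 ≤ e' u i
  bd1 : ∀ u i, T.b u ∈ s → e' u i ≤ 1
  eq0 : ∀ u i, T.b u ∈ s → T.e u i = T.X0 → e' u i = 0
  eq1 : ∀ u i, T.b u ∈ s → T.e u i = T.X1 → e' u i = 1
  ord : ∀ u w i k, T.b u ∈ s → T.b w ∈ s → T.b u ≤ T.t w → T.b w ≤ T.t u →
    T.e u i < T.e w k → e' u i < e' w k
  ordeq : ∀ u w i k, T.b u ∈ s → T.b w ∈ s → T.b u ≤ T.t w → T.b w ≤ T.t u →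
    T.e u i = T.e w k → e' u i = e' w k
  vc : ∀ u v, T.b u ∈ s → T.b v ∈ s → T.e u true = T.e v false → T.b u < T.t v → T.b v < T.t u →
    Y (T.b u) < y u + (y v - y u) * ((e' u true - x u) / (x v - x u)) ∧
    Y (T.b v) < y u + (y v - y u) * ((e' u true - x u) / (x v - x u))
  hc : ∀ u v, T.b u ∈ s → T.b v ∈ s → T.t u = T.b v → T.e u false < T.e v true →
    T.e v false < T.e u true →
    e' u false < x u + (x v - x u) * ((Y (T.t u) - y u) / (y v - y u)) ∧
    x u + (x v - x u) * ((Y (T.t u) - y u) / (y v - y u)) < e' u true ∧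
    e' v false < x u + (x v - x u) * ((Y (T.t u) - y u) / (y v - y u)) ∧
    x u + (x v - x u) * ((Y (T.t u) - y u) / (y v - y u)) < e' v true

theorem Tl.inX0 {V : Type*} (T : Tl V) (v : V) (i : Bool) : T.X0 ≤ T.e v i := by
  cases i
  · exact T.inl v
  · exact (T.inl v).trans (T.lr v).le

theorem Tl.inX1 {V : Type*} (T : Tl V) (v : V) (i : Bool) : T.e v i ≤ T.X1 := by
  cases i
  · exact (T.lr v).le.trans (T.inr v)
  · exact T.inr v

/-- Extending the invariant by one level, given coordinates for the new level. -/
theorem Good.extend {V : Type*} {T : Tl V} {s : Finset ℝ} {Y : ℝ → ℝ} {e' : V → Bool → ℝ}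
    {x y : V → ℝ} (g : Good T s Y e' x y) (a Ya ys : ℝ) (F : ℝ → ℝ) (xn : V → ℝ)
    (has : ∀ c ∈ s, c < a) (hYa : ∀ c ∈ s, Y c < Ya) (hya : ∀ u, T.b u ∈ s → y u < Ya)
    (hys : Ya < ys)
    (hF : ∀ c d, T.X0 ≤ c → c < d → d ≤ T.X1 → F c < F d)
    (hF0 : F T.X0 = 0) (hF1 : F T.X1 = 1)
    (hFo : ∀ u i, T.b u ∈ s → a ≤ T.t u → F (T.e u i) = e' u i)
    (hxl : ∀ v, T.b v = a → F (T.e v false) < xn v)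
    (hxr : ∀ v, T.b v = a → xn v < F (T.e v true))
    (hv1 : ∀ u v, T.b u ∈ s → T.b v = a → T.e u true = T.e v false → a < T.t u →
      Ya < y u + (ys - y u) * ((e' u true - x u) / (xn v - x u)))
    (hv2 : ∀ u v, T.b v ∈ s → T.b u = a → T.e u true = T.e v false → a < T.t v →
      Ya < ys + (y v - ys) * ((e' v false - xn u) / (x v - xn u)))
    (hh : ∀ u v, T.b u ∈ s → T.b v = a → T.t u = a → T.e u false < T.e v true →
      T.e v false < T.e u true →
      e' u false < x u + (xn v - x u) * ((Ya - y u) / (ys - y u)) ∧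
      x u + (xn v - x u) * ((Ya - y u) / (ys - y u)) < e' u true ∧
      F (T.e v false) < x u + (xn v - x u) * ((Ya - y u) / (ys - y u)) ∧
      x u + (xn v - x u) * ((Ya - y u) / (ys - y u)) < F (T.e v true)) :
    ∃ Y e' x y, Good T (insert a s) Y e' x y := by
  classical
  have hsa : ∀ c ∈ s, c ≠ a := fun c hc => (has c hc).ne
  have hF01 : ∀ u i, 0 ≤ F (T.e u i) ∧ F (T.e u i) ≤ 1 := by
    intro u i
    constructor
    · rcases (T.inX0 u i).eq_or_lt with h | h
      · rw [← h, hF0]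
      · have := hF _ _ le_rfl h (T.inX1 u i); linarith
    · rcases (T.inX1 u i).eq_or_lt with h | h
      · rw [h, hF1]
      · have := hF _ _ (T.inX0 u i) h le_rfl; linarith
  -- uniform description of coordinates touching level a
  have key : ∀ u i, (T.b u = a ∨ (T.b u ∈ s ∧ a ≤ T.t u)) →
      (if T.b u = a then F (T.e u i) else e' u i) = F (T.e u i) := by
    intro u i h
    split_ifs with h1
    · rfl
    · rcases h with h | h
      · exact absurd h h1
      · exact (hFo u i h.1 h.2).symm
  refine ⟨fun c => if c = a then Ya else Y c, fun u i => if T.b u = a then F (T.e u i) else e' u i,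
    fun u => if T.b u = a then xn u else x u, fun u => if T.b u = a then ys else y u, ?_⟩
  have ms : ∀ c, c ∈ insert a s → c = a ∨ (c ∈ s ∧ c ≠ a ∧ c < a) := by
    intro c hc
    rcases Finset.mem_insert.1 hc with h | h
    · exact Or.inl h
    · exact Or.inr ⟨h, hsa c h, has c h⟩
  have tch : ∀ u w, T.b u ∈ insert a s → T.b w ∈ insert a s → T.b u ≤ T.t w → T.b w ≤ T.t u →
      (T.b u ∈ s ∧ T.b w ∈ s ∧ T.b u ≠ a ∧ T.b w ≠ a) ∨
      ((T.b u = a ∨ (T.b u ∈ s ∧ a ≤ T.t u)) ∧ (T.b w = a ∨ (T.b w ∈ s ∧ a ≤ T.t w))) := by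
    intro u w hu hw h1 h2
    rcases ms _ hu with h3 | ⟨h3, h3', _⟩ <;> rcases ms _ hw with h4 | ⟨h4, h4', _⟩
    · exact Or.inr ⟨Or.inl h3, Or.inl h4⟩
    · exact Or.inr ⟨Or.inl h3, Or.inr ⟨h4, h3 ▸ h1⟩⟩
    · exact Or.inr ⟨Or.inr ⟨h3, h4 ▸ h2⟩, Or.inl h4⟩
    · exact Or.inl ⟨h3, h4, h3', h4'⟩
  constructor
  · intro c hc d hd hcd
    rcases ms _ hc with h3 | ⟨h3, h3', h3''⟩ <;> rcases ms _ hd with h4 | ⟨h4, h4', h4''⟩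
    · exact absurd hcd (by rw [h3, h4]; exact lt_irrefl _)
    · exact absurd hcd (by rw [h3]; exact h4''.not_gt)
    · simp only [h4, h3', if_true, if_false]; exact hYa c h3
    · simp only [h4', h3', if_false]; exact g.Ym c h3 d h4 hcd
  · intro u hu
    rcases ms _ hu with h | ⟨h, h', _⟩
    · simpa [h] using hys
    · simpa [h'] using g.ylo u h
  · intro u hu c hc huc
    rcases ms _ hu with h3 | ⟨h3, h3', h3''⟩ <;> rcases ms _ hc with h4 | ⟨h4, h4', h4''⟩
    · exact absurd huc (by rw [h3, h4]; exact lt_irrefl _)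
    · exact absurd huc (by rw [h3]; exact h4''.not_gt)
    · simp only [h4, h3', if_true, if_false]; exact hya u h3
    · simp only [h4', h3', if_false]; exact g.yhi u h3 c h4 huc
  · intro u hu
    rcases ms _ hu with h | ⟨h, h', _⟩
    · simpa [h] using hxl u h
    · simpa [h'] using g.xlo u h
  · intro u hu
    rcases ms _ hu with h | ⟨h, h', _⟩
    · simpa [h] using hxr u h
    · simpa [h'] using g.xhi u h
  · intro u i hu
    rcases ms _ hu with h | ⟨h, h', _⟩
    · simpa [h] using (hF01 u i).1
    · simpa [h'] using g.bd0 u i h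
  · intro u i hu
    rcases ms _ hu with h | ⟨h, h', _⟩
    · simpa [h] using (hF01 u i).2
    · simpa [h'] using g.bd1 u i h
  · intro u i hu he
    rcases ms _ hu with h | ⟨h, h', _⟩
    · simpa [h, he] using hF0
    · simpa [h'] using g.eq0 u i h he
  · intro u i hu he
    rcases ms _ hu with h | ⟨h, h', _⟩
    · simpa [h, he] using hF1
    · simpa [h'] using g.eq1 u i h he
  · intro u w i k hu hw h1 h2 he
    rcases tch u w hu hw h1 h2 with ⟨h3, h4, h5, h6⟩ | ⟨h3, h4⟩
    · simp only [h5, h6, if_false]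
      exact g.ord u w i k h3 h4 h1 h2 he
    · rw [key u i h3, key w k h4]
      exact hF _ _ (T.inX0 _ _) he (T.inX1 _ _)
  · intro u w i k hu hw h1 h2 he
    rcases tch u w hu hw h1 h2 with ⟨h3, h4, h5, h6⟩ | ⟨h3, h4⟩
    · simp only [h5, h6, if_false]
      exact g.ordeq u w i k h3 h4 h1 h2 he
    · rw [key u i h3, key w k h4, he]
  · intro u v hu hv he h1 h2
    rcases ms _ hu with h3 | ⟨h3, h3', h3''⟩ <;> rcases ms _ hv with h4 | ⟨h4, h4', h4''⟩
    · simp only [h3, h4, if_true, sub_self, zero_mul, add_zero]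
      exact ⟨hys, hys⟩
    · simp only [h3, h4', if_true, if_false]
      have := hv2 u v h4 h3 he (h3 ▸ h1)
      rw [he, hFo v false h4 (h3 ▸ h1.le)]
      exact ⟨this, (hYa _ h4).trans this⟩
    · simp only [h3', h4, if_true, if_false]
      have := hv1 u v h3 h4 he (h4 ▸ h2)
      exact ⟨(hYa _ h3).trans this, this⟩
    · simp only [h3', h4', if_false]
      exact g.vc u v h3 h4 he h1 h2
  · intro u v hu hv he h1 h2
    rcases ms _ hu with h3 | ⟨h3, h3', h3''⟩ <;> rcases ms _ hv with h4 | ⟨h4, h4', h4''⟩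
    · exact absurd (T.bt u) (by rw [he, h3, h4]; exact lt_irrefl _)
    · exact absurd (T.bt u) (by rw [he, h3]; exact h4''.not_gt)
    · have := hh u v h3 h4 (he.trans h4) h1 h2
      simp only [h3', h4, he, if_true, if_false]
      exact this
    · have := g.hc u v h3 h4 he h1 h2
      simp only [h3', h4', he, if_false]
      rw [he] at this
      exact this


theorem exists_ub {ι : Type*} [Finite ι] (f : ι → ℝ) : ∃ M, ∀ i, f i < M := by
  obtain ⟨M, hM⟩ := (Set.finite_range f).bddAbove
  exact ⟨M + 1, fun i => by have := hM ⟨i, rfl⟩; linarith⟩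

theorem exists_lb {ι : Type*} [Finite ι] (f : ι → ℝ) (p : ι → Prop) (hf : ∀ i, p i → 0 < f i) :
    ∃ m, 0 < m ∧ m ≤ 1 ∧ ∀ i, p i → m ≤ f i := by
  obtain ⟨M, hM⟩ := exists_ub fun i => (f i)⁻¹
  refine ⟨(max M 1)⁻¹, by positivity, inv_le_one_of_one_le₀ (le_max_right _ _), fun i hi => ?_⟩
  have := hf i hi
  rw [inv_le_comm₀ (by positivity) this]
  exact (hM i).le.trans (le_max_left _ _)

theorem Good.base {V : Type*} (T : Tl V) (a : ℝ) :
    ∃ Y e' x y, Good T (insert a ∅) Y e' x y := by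
  have g0 : Good T ∅ (fun _ => 0) (fun _ _ => 0) (fun _ => 0) (fun _ => 0) := by
    constructor <;> simp
  have hX : 0 < T.X1 - T.X0 := sub_pos.2 T.X01
  have hF : ∀ c d, c < d → (c - T.X0) / (T.X1 - T.X0) < (d - T.X0) / (T.X1 - T.X0) := by
    intro c d h
    gcongr
  refine g0.extend a 0 1 (fun c => (c - T.X0) / (T.X1 - T.X0))
    (fun v => ((T.e v false - T.X0) / (T.X1 - T.X0) + (T.e v true - T.X0) / (T.X1 - T.X0)) / 2)
    (by simp) (by simp) (by simp) one_pos (fun c d _ h _ => hF c d h) (by simp)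
    (by simp [hX.ne']) (by simp) ?_ ?_ (by simp) (by simp) (by simp)
  · intro v _
    have := hF _ _ (T.lr v)
    linarith
  · intro v _
    have := hF _ _ (T.lr v)
    linarith

theorem Good.step {V : Type*} [Finite V] {T : Tl V} {s : Finset ℝ} {Y : ℝ → ℝ}
    {e' : V → Bool → ℝ} {x y : V → ℝ} (g : Good T s Y e' x y) (a : ℝ)
    (has : ∀ c ∈ s, c < a) (hbs : ∀ u, T.b u < a → T.b u ∈ s)
    (hrow : ∀ p, T.X0 ≤ p → p ≤ T.X1 →
      ∃ v, T.b v < a ∧ a ≤ T.t v ∧ T.e v false ≤ p ∧ p ≤ T.e v true) :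
    ∃ Y e' x y, Good T (insert a s) Y e' x y := by
  classical
  -- constants
  obtain ⟨M1, hM1⟩ := exists_ub fun c : s => Y c
  obtain ⟨M2, hM2⟩ := exists_ub y
  obtain ⟨Ya, hYa1, hYa2⟩ : ∃ Ya, M1 ≤ Ya ∧ M2 ≤ Ya := ⟨max M1 M2, le_max_left _ _, le_max_right _ _⟩
  have hYs : ∀ c ∈ s, Y c < Ya := fun c hc => (hM1 ⟨c, hc⟩).trans_le hYa1
  have hyY : ∀ u, y u < Ya := fun u => (hM2 u).trans_le hYa2
  obtain ⟨m1, hm1, -, hm1'⟩ := exists_lb (fun u => x u - e' u false) (fun u => T.b u ∈ s)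
    (fun u hu => sub_pos.2 (g.xlo u hu))
  obtain ⟨m2, hm2, -, hm2'⟩ := exists_lb (fun u => e' u true - x u) (fun u => T.b u ∈ s)
    (fun u hu => sub_pos.2 (g.xhi u hu))
  obtain ⟨m, hm, hml, hmr⟩ : ∃ m, 0 < m ∧ (∀ u, T.b u ∈ s → m ≤ x u - e' u false) ∧
      (∀ u, T.b u ∈ s → m ≤ e' u true - x u) :=
    ⟨min m1 m2, lt_min hm1 hm2, fun u hu => (min_le_left _ _).trans (hm1' u hu),
      fun u hu => (min_le_right _ _).trans (hm2' u hu)⟩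
  obtain ⟨D, hD⟩ := exists_ub fun u => (Ya - y u) / m + y u
  obtain ⟨ys, hys, hysD⟩ : ∃ ys, Ya < ys ∧ D ≤ ys :=
    ⟨max (Ya + 1) D, lt_max_of_lt_left (by linarith), le_max_right _ _⟩
  have hyys : ∀ u, y u < ys := fun u => (hyY u).trans hys
  have hmy : ∀ u, Ya - y u < m * (ys - y u) := by
    intro u
    have h1 := (hD u).trans_le hysD
    have h2 : (Ya - y u) / m < ys - y u := by linarith
    rw [div_lt_iff₀ hm] at h2
    linarith
  obtain ⟨Q, hQ1, hQ⟩ : ∃ Q, 1 < Q ∧ ∀ u, ys - y u < Q * (Ya - y u) := by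
    obtain ⟨Q, hQ⟩ := exists_ub fun u => (ys - y u) / (Ya - y u)
    refine ⟨max Q 2, lt_max_of_lt_right (by norm_num), fun u => ?_⟩
    have := (hQ u).trans_le (le_max_left Q 2)
    rwa [div_lt_iff₀ (sub_pos.2 (hyY u))] at this
  obtain ⟨Λ, hΛ0, hΛ⟩ : ∃ Λ : ℝ, 0 < Λ ∧ ∀ v w i k, T.e v i < T.e w k →
      Q * Real.exp (Λ * T.e v i) < Real.exp (Λ * T.e w k) := by
    obtain ⟨d, hd, -, hd'⟩ := exists_lb (fun z : (V × Bool) × (V × Bool) =>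
      T.e z.2.1 z.2.2 - T.e z.1.1 z.1.2) (fun z => T.e z.1.1 z.1.2 < T.e z.2.1 z.2.2)
      (fun z hz => sub_pos.2 hz)
    have hL : 0 < Real.log Q := Real.log_pos hQ1
    refine ⟨(Real.log Q + 1) / d, by positivity, fun v w i k h => ?_⟩
    have h1 := hd' ((v, i), (w, k)) h
    simp only at h1
    have h2 : Q * Real.exp ((Real.log Q + 1) / d * T.e v i) =
        Real.exp (Real.log Q) * Real.exp ((Real.log Q + 1) / d * T.e v i) := by
      rw [Real.exp_log (by linarith)]
    rw [h2, ← Real.exp_add, Real.exp_lt_exp]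
    have h3 : (Real.log Q + 1) / d * d ≤ (Real.log Q + 1) / d * (T.e w k - T.e v i) := by gcongr
    rw [div_mul_cancel₀ _ hd.ne'] at h3
    linarith
  obtain ⟨δ, hδ, hδm⟩ : ∃ δ : ℝ, 0 < δ ∧ ∀ c, c ≤ T.X1 → Q * (δ * Real.exp (Λ * c)) < m := by
    refine ⟨m / (2 * Q * Real.exp (Λ * T.X1)), by positivity, fun c hc => ?_⟩
    have h1 : Real.exp (Λ * c) ≤ Real.exp (Λ * T.X1) := by
      rw [Real.exp_le_exp]; gcongr
    have hQ0 : 0 < Q := by linarith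
    calc Q * (m / (2 * Q * Real.exp (Λ * T.X1)) * Real.exp (Λ * c))
        ≤ Q * (m / (2 * Q * Real.exp (Λ * T.X1)) * Real.exp (Λ * T.X1)) := by gcongr
      _ = m / 2 := by field_simp
      _ < m := by linarith
  -- the touching row
  let old : V → Prop := fun u => T.b u < a ∧ a ≤ T.t u
  have olds : ∀ u, old u → T.b u ∈ s := fun u hu => hbs u hu.1
  have oldd : ∀ u w, old u → old w → u ≠ w →
      T.e u true ≤ T.e w false ∨ T.e w true ≤ T.e u false := by
    intro u w hu hw huw
    by_contra! h
    exact T.disj u w huw h.2 h.1 (hu.1.trans_le hw.2) (hw.1.trans_le hu.2)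
  have oldi : ∀ u w i, old u → old w → T.e w i ≤ T.e u false ∨ T.e u true ≤ T.e w i := by
    intro u w i hu hw
    have hlr := T.lr w
    by_cases huw : u = w
    · subst huw; cases i
      · exact Or.inl le_rfl
      · exact Or.inr le_rfl
    · rcases oldd u w hu hw huw with h | h
      · right; cases i
        · exact h
        · linarith
      · left; cases i
        · linarith
        · exact h
  have oldlt : ∀ u w i k, old u → old w → T.e u i < T.e w k → e' u i < e' w k :=
    fun u w i k hu hw => g.ord u w i k (olds u hu) (olds w hw)
      (hu.1.trans_le hw.2).le (hw.1.trans_le hu.2).le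
  have oldeq : ∀ u w i k, old u → old w → T.e u i = T.e w k → e' u i = e' w k :=
    fun u w i k hu hw => g.ordeq u w i k (olds u hu) (olds w hw)
      (hu.1.trans_le hw.2).le (hw.1.trans_le hu.2).le
  have oldle : ∀ u w i k, old u → old w → T.e u i ≤ T.e w k → e' u i ≤ e' w k := by
    intro u w i k hu hw h
    rcases h.eq_or_lt with h | h
    · exact (oldeq u w i k hu hw h).le
    · exact (oldlt u w i k hu hw h).le
  -- the coordinate map
  let F : ℝ → ℝ := fun c =>
    if h : ∃ z : V × Bool, old z.1 ∧ T.e z.1 z.2 = c then e' h.choose.1 h.choose.2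
    else if h : ∃ u, old u ∧ T.e u false < c ∧ c < T.e u true then
      x h.choose + δ * Real.exp (Λ * c) else 0
  have F1 : ∀ u i, old u → F (T.e u i) = e' u i := by
    intro u i hu
    have h : ∃ z : V × Bool, old z.1 ∧ T.e z.1 z.2 = T.e u i := ⟨(u, i), hu, rfl⟩
    simp only [F, dif_pos h]
    exact oldeq _ _ _ _ h.choose_spec.1 hu h.choose_spec.2
  have F2 : ∀ u c, old u → T.e u false < c → c < T.e u true →
      F c = x u + δ * Real.exp (Λ * c) := by
    intro u c hu h1 h2
    have h : ¬ ∃ z : V × Bool, old z.1 ∧ T.e z.1 z.2 = c := by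
      rintro ⟨⟨w, i⟩, hw, rfl⟩
      rcases oldi u w i hu hw with h | h
      · exact h1.not_ge h
      · exact h2.not_ge h
    have h' : ∃ u, old u ∧ T.e u false < c ∧ c < T.e u true := ⟨u, hu, h1, h2⟩
    simp only [F, dif_neg h, dif_pos h']
    have : h'.choose = u := by
      by_contra hne
      obtain ⟨h3, h4, h5⟩ := h'.choose_spec
      rcases oldd _ _ h3 hu hne with h | h <;> linarith
    rw [this]
  have F3 : ∀ c, T.X0 ≤ c → c ≤ T.X1 → (∃ u i, old u ∧ T.e u i = c) ∨
      (∃ u, old u ∧ T.e u false < c ∧ c < T.e u true) := by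
    intro c h0 h1
    obtain ⟨v, hv1, hv2, hv3, hv4⟩ := hrow c h0 h1
    rcases hv3.eq_or_lt with h | h
    · exact Or.inl ⟨v, false, ⟨hv1, hv2⟩, h⟩
    rcases hv4.eq_or_lt with h' | h'
    · exact Or.inl ⟨v, true, ⟨hv1, hv2⟩, h'.symm⟩
    · exact Or.inr ⟨v, ⟨hv1, hv2⟩, h, h'⟩
  have hE : ∀ c, 0 < δ * Real.exp (Λ * c) := fun c => by positivity
  have hEm : ∀ c, c ≤ T.X1 → δ * Real.exp (Λ * c) < m := by
    intro c hc
    have := hδm c hc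
    have := hE c
    nlinarith
  have hF : ∀ c d, T.X0 ≤ c → c < d → d ≤ T.X1 → F c < F d := by
    intro c d hc hcd hd
    rcases F3 c hc (hcd.le.trans hd) with ⟨u, i, hu, rfl⟩ | ⟨u, hu, hu1, hu2⟩ <;>
    rcases F3 d (hc.trans hcd.le) hd with ⟨w, k, hw, rfl⟩ | ⟨w, hw, hw1, hw2⟩
    · rw [F1 u i hu, F1 w k hw]
      exact oldlt _ _ _ _ hu hw hcd
    · rw [F1 u i hu, F2 w d hw hw1 hw2]
      have h1 : T.e u i ≤ T.e w false := by
        rcases oldi w u i hw hu with h | h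
        · exact h
        · linarith
      have h2 := oldle _ _ _ _ hu hw h1
      have h3 := g.xlo w (olds w hw)
      have := hE d
      linarith
    · rw [F1 w k hw, F2 u c hu hu1 hu2]
      have h1 : T.e u true ≤ T.e w k := by
        rcases oldi u w k hu hw with h | h
        · linarith
        · exact h
      have h2 := oldle _ _ _ _ hu hw h1
      have h3 := hmr u (olds u hu)
      have := hEm c (hcd.le.trans hd)
      linarith
    · rw [F2 u c hu hu1 hu2, F2 w d hw hw1 hw2]
      by_cases huw : u = w
      · subst huw
        have : Real.exp (Λ * c) < Real.exp (Λ * d) := by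
          rw [Real.exp_lt_exp]; gcongr
        gcongr
      · rcases oldd u w hu hw huw with h | h
        · have h2 := oldle _ _ _ _ hu hw h
          have h3 := hmr u (olds u hu)
          have := hEm c (hcd.le.trans hd)
          have h3 := g.xlo w (olds w hw)
          have := hE d
          linarith
        · linarith
  have hFle : ∀ c d, T.X0 ≤ c → c ≤ d → d ≤ T.X1 → F c ≤ F d := by
    intro c d hc hcd hd
    rcases hcd.eq_or_lt with h | h
    · rw [h]
    · exact (hF c d hc h hd).le
  have hF0 : F T.X0 = 0 := by
    rcases F3 T.X0 le_rfl T.X01.le with ⟨u, i, hu, h⟩ | ⟨u, hu, h, -⟩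
    · rw [← h, F1 u i hu, g.eq0 u i (olds u hu) h]
    · exact absurd (T.inl u) h.not_ge
  have hF1 : F T.X1 = 1 := by
    rcases F3 T.X1 T.X01.le le_rfl with ⟨u, i, hu, h⟩ | ⟨u, hu, -, h⟩
    · rw [← h, F1 u i hu, g.eq1 u i (olds u hu) h]
    · exact absurd (T.inr u) h.not_ge
  -- the new abscissae
  let xn : V → ℝ := fun v =>
    if h : ∃ u, old u ∧ T.e u false < T.e v false ∧ T.e v false < T.e u true then
      x h.choose + Q * (δ * Real.exp (Λ * T.e v false))
    else (F (T.e v false) + F (T.e v true)) / 2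
  have xn1 : ∀ u v, old u → T.e u false < T.e v false → T.e v false < T.e u true →
      xn v = x u + Q * (δ * Real.exp (Λ * T.e v false)) := by
    intro u v hu h1 h2
    have h' : ∃ u, old u ∧ T.e u false < T.e v false ∧ T.e v false < T.e u true :=
      ⟨u, hu, h1, h2⟩
    simp only [xn, dif_pos h']
    have : h'.choose = u := by
      by_contra hne
      obtain ⟨h3, h4, h5⟩ := h'.choose_spec
      rcases oldd _ _ h3 hu hne with h | h <;> linarith
    rw [this]
  have hlrF : ∀ v, F (T.e v false) < F (T.e v true) := fun v =>
    hF _ _ (T.inX0 _ _) (T.lr v) (T.inX1 _ _)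
  have xnlr : ∀ v, F (T.e v false) < xn v ∧ xn v < F (T.e v true) := by
    intro v
    by_cases h : ∃ u, old u ∧ T.e u false < T.e v false ∧ T.e v false < T.e u true
    · obtain ⟨u, hu, h1, h2⟩ := h
      rw [xn1 u v hu h1 h2, F2 u _ hu h1 h2]
      have h3 := hE (T.e v false)
      refine ⟨by nlinarith, ?_⟩
      by_cases h4 : T.e v true < T.e u true
      · rw [F2 u _ hu (h1.trans (T.lr v)) h4]
        have := hΛ v v false true (T.lr v)
        have : δ * (Q * Real.exp (Λ * T.e v false)) < δ * Real.exp (Λ * T.e v true) := by gcongr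
        linarith
      · have h5 := hFle _ _ (T.inX0 u true) (not_lt.1 h4) (T.inX1 v true)
        rw [F1 u true hu] at h5
        have h3 := hmr u (olds u hu)
        have := hδm _ (T.inX1 v false)
        linarith
    · simp only [xn, dif_neg h]
      have := hlrF v
      constructor <;> linarith
  have hF01 : ∀ u i, 0 ≤ F (T.e u i) ∧ F (T.e u i) ≤ 1 := by
    intro u i
    have h1 := hFle _ _ le_rfl (T.inX0 u i) (T.inX1 u i)
    have h2 := hFle _ _ (T.inX0 u i) (T.inX1 u i) le_rfl
    rw [hF0] at h1
    rw [hF1] at h2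
    exact ⟨h1, h2⟩
  have xn01 : ∀ v, 0 < xn v ∧ xn v < 1 := fun v =>
    ⟨(hF01 v false).1.trans_lt (xnlr v).1, (xnlr v).2.trans_le (hF01 v true).2⟩
  have x01 : ∀ v, T.b v ∈ s → 0 < x v ∧ x v < 1 := fun v hv =>
    ⟨(g.bd0 v false hv).trans_lt (g.xlo v hv), (g.xhi v hv).trans_le (g.bd1 v true hv)⟩
  refine g.extend a Ya ys F xn has hYs (fun u _ => hyY u) hys hF hF0 hF1
    (fun u i hu ha => F1 u i ⟨has _ hu, ha⟩) (fun v _ => (xnlr v).1) (fun v _ => (xnlr v).2)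
    ?_ ?_ ?_
  · intro u v hu hv he ha
    have hX : F (T.e v false) = e' u true := by rw [← he, F1 u true ⟨has _ hu, ha.le⟩]
    have h1 := (xnlr v).1
    have h2 := hmr u hu
    have h3 := xn01 v
    have h4 := x01 u hu
    have h5 := hmy u
    have h6 := hyys u
    have h7 : m ≤ (e' u true - x u) / (xn v - x u) := by
      rw [le_div_iff₀ (by linarith)]
      nlinarith
    have h8 : (ys - y u) * m ≤ (ys - y u) * ((e' u true - x u) / (xn v - x u)) := by
      apply mul_le_mul_of_nonneg_left h7; linarith
    linarith
  · intro u v hv hu he ha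
    have hX : F (T.e u true) = e' v false := by rw [he, F1 v false ⟨has _ hv, ha.le⟩]
    have h1 := (xnlr u).2
    have h2 := hml v hv
    have h3 := xn01 u
    have h4 := x01 v hv
    have h5 := hmy v
    have h6 := hyys v
    have hpos : 0 < x v - xn u := by linarith
    have h7 : m ≤ (x v - e' v false) / (x v - xn u) := by
      rw [le_div_iff₀ hpos]
      nlinarith
    have h8 : (ys - y v) * m ≤ (ys - y v) * ((x v - e' v false) / (x v - xn u)) := by
      apply mul_le_mul_of_nonneg_left h7; linarith
    have h9 : (e' v false - xn u) / (x v - xn u) = 1 - (x v - e' v false) / (x v - xn u) := by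
      field_simp; ring
    rw [h9]
    linarith
  · intro u v hu hv ht h1 h2
    have ho : old u := ⟨has _ hu, ht.ge⟩
    obtain ⟨θ, hθ⟩ : ∃ θ, θ = (Ya - y u) / (ys - y u) := ⟨_, rfl⟩
    rw [← hθ]
    have hp : 0 < ys - y u := sub_pos.2 (hyys u)
    have hθ0 : 0 < θ := by rw [hθ]; exact div_pos (sub_pos.2 (hyY u)) hp
    have hθ1 : θ < 1 := by rw [hθ, div_lt_one hp]; linarith
    have hθm : θ < m := by rw [hθ, div_lt_iff₀ hp]; exact hmy u
    have hθQ : 1 < θ * Q := by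
      have := hQ u
      rw [hθ, div_mul_eq_mul_div, lt_div_iff₀ hp]; linarith
    have h3 := xn01 v
    have h4 := x01 u hu
    have h5 := hml u hu
    have h6 := hmr u hu
    have h7 := xnlr v
    refine ⟨by nlinarith, by nlinarith, ?_, ?_⟩
    · by_cases h8 : F (T.e v false) < x u
      · have h9 : x u + (xn v - x u) * θ = (1 - θ) * x u + θ * xn v := by ring
        rw [h9]
        nlinarith
      · have h9 : T.e u false < T.e v false := by
          by_contra h9
          have := hFle _ _ (T.inX0 v false) (not_lt.1 h9) (T.inX1 u false)
          rw [F1 u false ho] at this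
          have := g.xlo u hu
          linarith
        rw [xn1 u v ho h9 h2, F2 u _ ho h9 h2]
        have := hE (T.e v false)
        nlinarith
    · have h8 : x u < F (T.e v true) := by
        by_cases h9 : T.e v true < T.e u true
        · rw [F2 u _ ho h1 h9]
          have := hE (T.e v true)
          linarith
        · have := hFle _ _ (T.inX0 u true) (not_lt.1 h9) (T.inX1 v true)
          rw [F1 u true ho] at this
          linarith
      have h9 : x u + (xn v - x u) * θ = (1 - θ) * x u + θ * xn v := by ring
      rw [h9]
      nlinarith


theorem exists_gap (S : Finset ℝ) (a B : ℝ) (h : a < B) :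
    ∃ p, a < p ∧ p < B ∧ ∀ c ∈ S, a < c → p < c := by
  induction S using Finset.induction_on with
  | empty => exact ⟨(a + B) / 2, by linarith, by linarith, by simp⟩
  | insert d S _ ih =>
    obtain ⟨p, h1, h2, h3⟩ := ih
    by_cases hd : a < d
    · refine ⟨min p ((a + d) / 2), lt_min h1 (by linarith), (min_le_left _ _).trans_lt h2, ?_⟩
      intro c hc hac
      rcases Finset.mem_insert.1 hc with rfl | hc
      · exact (min_le_right _ _).trans_lt (by linarith)
      · exact (min_le_left _ _).trans_lt (h3 c hc hac)
    · refine ⟨p, h1, h2, ?_⟩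
      intro c hc hac
      rcases Finset.mem_insert.1 hc with rfl | hc
      · exact absurd hac hd
      · exact h3 c hc hac

theorem exists_gap' (S : Finset ℝ) (a B : ℝ) (h : B < a) :
    ∃ p, p < a ∧ B < p ∧ ∀ c ∈ S, c < a → c < p := by
  obtain ⟨p, h1, h2, h3⟩ := exists_gap (S.image fun c => -c) (-a) (-B) (by linarith)
  refine ⟨-p, by linarith, by linarith, fun c hc hca => ?_⟩
  have := h3 (-c) (Finset.mem_image_of_mem _ hc) (by linarith)
  linarith

open Classical in
/-- All horizontal levels of the tiling. -/
noncomputable def Tl.lev {V : Type*} [Fintype V] (T : Tl V) : Finset ℝ :=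
  Finset.univ.image T.b ∪ Finset.univ.image T.t

theorem Tl.b_lev {V : Type*} [Fintype V] (T : Tl V) (v : V) : T.b v ∈ T.lev := by
  simp [Tl.lev]

theorem Tl.t_lev {V : Type*} [Fintype V] (T : Tl V) (v : V) : T.t v ∈ T.lev := by
  simp [Tl.lev]

theorem Tl.lev_bd {V : Type*} [Fintype V] (T : Tl V) (c : ℝ) (hc : c ∈ T.lev) :
    T.Y0 ≤ c ∧ c ≤ T.Y1 := by
  simp only [Tl.lev, Finset.mem_union, Finset.mem_image, Finset.mem_univ, true_and] at hc
  rcases hc with ⟨v, rfl⟩ | ⟨v, rfl⟩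
  · exact ⟨T.inb v, (T.bt v).le.trans (T.intop v)⟩
  · exact ⟨(T.inb v).trans (T.bt v).le, T.intop v⟩

theorem Good.exists {V : Type*} [Fintype V] (T : Tl V) :
    ∃ Y e' x y, Good T T.lev Y e' x y := by
  classical
  have H : ∀ s : Finset ℝ, s ⊆ T.lev → (∀ z ∈ T.lev, ∀ c ∈ s, z ≤ c → z ∈ s) →
      ∃ Y e' x y, Good T s Y e' x y := by
    intro s
    induction s using Finset.induction_on_max with
    | empty =>
      intro _ _
      exact ⟨fun _ => 0, fun _ _ => 0, fun _ => 0, fun _ => 0, by constructor <;> simp⟩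
    | insert a s has ih =>
      intro hs hdown
      have hsl : s ⊆ T.lev := (Finset.subset_insert a s).trans hs
      have haL : a ∈ T.lev := hs (Finset.mem_insert_self _ _)
      have hlt : ∀ z ∈ T.lev, z < a → z ∈ s := by
        intro z hz hza
        rcases Finset.mem_insert.1 (hdown z hz a (Finset.mem_insert_self _ _) hza.le) with h | h
        · exact absurd h hza.ne
        · exact h
      rcases s.eq_empty_or_nonempty with rfl | ⟨c0, hc0⟩
      · exact Good.base T a
      · obtain ⟨Y, e', x, y, g⟩ := ih hsl (fun z hz c hc hzc => hlt z hz (hzc.trans_lt (has c hc)))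
        refine g.step a has (fun u hu => hlt _ (T.b_lev u) hu) ?_
        intro p hp0 hp1
        have h0 : T.Y0 < a := (T.lev_bd c0 (hsl hc0)).1.trans_lt (has c0 hc0)
        obtain ⟨q, hq1, hq2, hq3⟩ := exists_gap' T.lev a T.Y0 h0
        obtain ⟨v, h1, h2, h3, h4⟩ := T.cover p q hp0 hp1 hq2.le
          (hq1.le.trans (T.lev_bd a haL).2)
        refine ⟨v, h3.trans_lt hq1, ?_, h1, h2⟩
        by_contra h
        exact absurd (hq3 _ (T.t_lev v) (not_le.1 h)) h4.not_gt
  exact H T.lev subset_rfl (fun z hz _ _ _ => hz)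


theorem interior_rc (l r b t : ℝ) :
    interior (Icc l r ×ˢ Icc b t : Set (ℝ × ℝ)) = Ioo l r ×ˢ Ioo b t := by
  rw [interior_prod_eq, interior_Icc, interior_Icc]

theorem twoPts {l1 r1 b1 t1 l2 r2 b2 t2 : ℝ} (h1 : l1 < r1) (h2 : b1 < t1) (h3 : l2 < r2)
    (h4 : b2 < t2) :
    HasTwoPoints ((Icc l1 r1 ×ˢ Icc b1 t1) ∩ (Icc l2 r2 ×ˢ Icc b2 t2)) ↔
      l1 ≤ r2 ∧ l2 ≤ r1 ∧ b1 ≤ t2 ∧ b2 ≤ t1 ∧ ((l1 < r2 ∧ l2 < r1) ∨ (b1 < t2 ∧ b2 < t1)) := by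
  constructor
  · rintro ⟨⟨p1, p2⟩, ⟨q1, q2⟩, hne, hp, hq⟩
    simp only [mem_inter_iff, mem_prod, mem_Icc] at hp hq
    obtain ⟨⟨⟨a1, a2⟩, a3, a4⟩, ⟨a5, a6⟩, a7, a8⟩ := hp
    obtain ⟨⟨⟨c1, c2⟩, c3, c4⟩, ⟨c5, c6⟩, c7, c8⟩ := hq
    refine ⟨by linarith, by linarith, by linarith, by linarith, ?_⟩
    by_cases h : p1 = q1
    · have h' : p2 ≠ q2 := fun h' => hne (by rw [h, h'])
      right
      rcases lt_or_gt_of_ne h' with h' | h' <;> constructor <;> linarith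
    · left
      rcases lt_or_gt_of_ne h with h' | h' <;> constructor <;> linarith
  · rintro ⟨a1, a2, a3, a4, h⟩
    rcases h with ⟨c1, c2⟩ | ⟨c1, c2⟩
    · refine ⟨(max l1 l2, max b1 b2), (min r1 r2, max b1 b2), ?_, ?_, ?_⟩
      · intro h
        have h := congrArg Prod.fst h
        simp only at h
        have : max l1 l2 < min r1 r2 := max_lt (lt_min h1 c1) (lt_min c2 h3)
        linarith
      · simp [h1.le, h2.le, h3.le, h4.le, a1, a2, a3, a4]
      · simp [h1.le, h2.le, h3.le, h4.le, a1, a2, a3, a4]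
    · refine ⟨(max l1 l2, max b1 b2), (max l1 l2, min t1 t2), ?_, ?_, ?_⟩
      · intro h
        have h := congrArg Prod.snd h
        simp only at h
        have : max b1 b2 < min t1 t2 := max_lt (lt_min h2 c1) (lt_min c2 h4)
        linarith
      · simp [h1.le, h2.le, h3.le, h4.le, a1, a2, a3, a4]
      · simp [h1.le, h2.le, h3.le, h4.le, a1, a2, a3, a4]

theorem vertSeg {l1 r1 b1 t1 l2 r2 b2 t2 : ℝ} (h1 : l1 < r1) (h2 : b1 < t1) (h3 : l2 < r2)
    (h4 : b2 < t2) (a1 : l1 ≤ r2) (a2 : l2 ≤ r1) (a3 : b1 ≤ t2) (a4 : b2 ≤ t1) :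
    IsVerticalSeg ((Icc l1 r1 ×ˢ Icc b1 t1) ∩ (Icc l2 r2 ×ˢ Icc b2 t2)) ↔
      ¬ (l1 < r2 ∧ l2 < r1) := by
  constructor
  · rintro ⟨x, hx⟩ ⟨c1, c2⟩
    have e1 := hx (max l1 l2, max b1 b2) (by simp [h1.le, h2.le, h3.le, h4.le, a1, a2, a3, a4])
    have e2 := hx (min r1 r2, max b1 b2) (by simp [h1.le, h2.le, h3.le, h4.le, a1, a2, a3, a4])
    have : max l1 l2 < min r1 r2 := max_lt (lt_min h1 c1) (lt_min c2 h3)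
    simp only at e1 e2
    linarith
  · intro h
    refine ⟨max l1 l2, ?_⟩
    rintro ⟨p1, p2⟩ hp
    simp only [mem_inter_iff, mem_prod, mem_Icc] at hp ⊢
    obtain ⟨⟨⟨c1, c2⟩, -⟩, ⟨c3, c4⟩, -⟩ := hp
    apply le_antisymm _ (max_le c1 c3)
    by_contra h5
    rw [not_le, max_lt_iff] at h5
    exact h ⟨by linarith, by linarith⟩

theorem mem_intrinsic (s U : Set (ℝ × ℝ)) (f : ℝ × ℝ →ᵃ[ℝ] ℝ) (c : ℝ) (hs : ∀ p ∈ s, f p = c)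
    (hU : IsOpen U) (z : ℝ × ℝ) (hz : z ∈ s) (hzU : z ∈ U) (h : ∀ p ∈ U, f p = c → p ∈ s) :
    z ∈ intrinsicInterior ℝ s := by
  have key : ∀ p ∈ affineSpan ℝ s, f p = c := by
    have : affineSpan ℝ s ≤ (affineSpan ℝ {c}).comap f := by
      rw [affineSpan_le]
      intro p hp
      simp [hs p hp]
    intro p hp
    simpa using this hp
  exact mem_intrinsicInterior.2 ⟨⟨z, subset_affineSpan _ _ hz⟩,
    mem_interior.2 ⟨Subtype.val ⁻¹' U, fun p hp => h p hp (key p p.2),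
      hU.preimage continuous_subtype_val, hzU⟩, rfl⟩

/-- What we need to know about the segment drawn for an edge. -/
def EdgeP (A B : Set (ℝ × ℝ)) (p q : ℝ × ℝ) : Prop :=
  ∃ z, z ∈ segment ℝ p q ∧ z ∈ frontier A ∧ z ∈ frontier B ∧
    (∀ w ∈ segment ℝ p q, w = z ∨ w ∈ interior A ∨ w ∈ interior B) ∧
    z ∈ interior (A ∪ B) ∧ z ∈ intrinsicInterior ℝ (A ∩ B)

theorem EdgeP.symm {A B : Set (ℝ × ℝ)} {p q : ℝ × ℝ} (h : EdgeP A B p q) : EdgeP B A q p := by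
  obtain ⟨z, h1, h2, h3, h4, h5, h6⟩ := h
  refine ⟨z, segment_symm ℝ p q ▸ h1, h3, h2, fun w hw => ?_, union_comm A B ▸ h5,
    inter_comm A B ▸ h6⟩
  rcases h4 w (segment_symm ℝ q p ▸ hw) with h | h | h
  · exact Or.inl h
  · exact Or.inr (Or.inr h)
  · exact Or.inr (Or.inl h)

theorem seg_split {A B : Set (ℝ × ℝ)} (hA : Convex ℝ A) (hB : Convex ℝ B) {p q z : ℝ × ℝ}
    (hp : p ∈ interior A) (hq : q ∈ interior B) (hzA : z ∈ A) (hzB : z ∈ B)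
    (hz : z ∈ segment ℝ p q) :
    ∀ w ∈ segment ℝ p q, w = z ∨ w ∈ interior A ∨ w ∈ interior B := by
  intro w hw
  obtain ⟨a, b, ha, hb, hab, rfl⟩ := hz
  obtain ⟨c, d, hc, hd, hcd, rfl⟩ := hw
  rcases lt_trichotomy d b with h | h | h
  · right; left
    have hb0 : 0 < b := hd.trans_lt h
    have := hA.combo_interior_self_mem_interior hp hzA (a := 1 - d / b) (b := d / b)
      (by rw [sub_pos, div_lt_one hb0]; exact h) (by positivity) (by ring)
    convert this using 1
    have h1 : c = 1 - d := by linarith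
    have h2 : a = 1 - b := by linarith
    subst h1 h2
    rw [smul_add, smul_smul, smul_smul, ← add_assoc, ← add_smul]
    congr 2 <;> field_simp; ring
  · left
    have h1 : c = a := by linarith
    rw [h, h1]
  · right; right
    have ha0 : 0 < a := by linarith
    have := hB.combo_self_interior_mem_interior hzB hq (a := c / a) (b := 1 - c / a)
      (by positivity) (by rw [sub_pos, div_lt_one ha0]; linarith) (by ring)
    convert this using 1
    have h1 : d = 1 - c := by linarith
    have h2 : b = 1 - a := by linarith
    subst h1 h2
    rw [smul_add, smul_smul, smul_smul, add_assoc, ← add_smul]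
    congr 2 <;> field_simp; ring

theorem convex_rc (l r b t : ℝ) : Convex ℝ (Icc l r ×ˢ Icc b t : Set (ℝ × ℝ)) :=
  (convex_Icc l r).prod (convex_Icc b t)

theorem closed_rc (l r b t : ℝ) : IsClosed (Icc l r ×ˢ Icc b t : Set (ℝ × ℝ)) :=
  isClosed_Icc.prod isClosed_Icc

theorem edgeV {l1 X b1 t1 r2 b2 t2 x1 y1 x2 y2 : ℝ}
    (hp : (x1, y1) ∈ interior (Icc l1 X ×ˢ Icc b1 t1 : Set (ℝ × ℝ)))
    (hq : (x2, y2) ∈ interior (Icc X r2 ×ˢ Icc b2 t2 : Set (ℝ × ℝ)))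
    (h1 : b1 < y1 + (y2 - y1) * ((X - x1) / (x2 - x1)))
    (h2 : b2 < y1 + (y2 - y1) * ((X - x1) / (x2 - x1)))
    (h3 : y1 + (y2 - y1) * ((X - x1) / (x2 - x1)) < t1)
    (h4 : y1 + (y2 - y1) * ((X - x1) / (x2 - x1)) < t2) :
    EdgeP (Icc l1 X ×ˢ Icc b1 t1) (Icc X r2 ×ˢ Icc b2 t2) (x1, y1) (x2, y2) := by
  have hp' := hp
  have hq' := hq
  rw [interior_rc] at hp' hq'
  obtain ⟨⟨p1, p2⟩, p3, p4⟩ := hp'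
  obtain ⟨⟨q1, q2⟩, q3, q4⟩ := hq'
  simp only at p1 p2 p3 p4 q1 q2 q3 q4
  have hx : 0 < x2 - x1 := by linarith
  obtain ⟨τ, hτ⟩ : ∃ τ, τ = (X - x1) / (x2 - x1) := ⟨_, rfl⟩
  rw [← hτ] at h1 h2 h3 h4
  obtain ⟨W, hW⟩ : ∃ W, W = y1 + (y2 - y1) * τ := ⟨_, rfl⟩
  rw [← hW] at h1 h2 h3 h4
  have hτ0 : 0 ≤ τ := by rw [hτ]; exact div_nonneg (by linarith) hx.le
  have hτ1 : τ ≤ 1 := by rw [hτ, div_le_one hx]; linarith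
  have hτX : τ * (x2 - x1) = X - x1 := by rw [hτ, div_mul_cancel₀ _ hx.ne']
  have hzs : (X, W) ∈ segment ℝ (x1, y1) (x2, y2) := by
    refine ⟨1 - τ, τ, by linarith, hτ0, by ring, ?_⟩
    ext
    · simp; linarith
    · simp; linarith
  have hzA : (X, W) ∈ (Icc l1 X ×ˢ Icc b1 t1 : Set (ℝ × ℝ)) :=
    ⟨⟨by linarith, le_rfl⟩, h1.le, h3.le⟩
  have hzB : (X, W) ∈ (Icc X r2 ×ˢ Icc b2 t2 : Set (ℝ × ℝ)) :=
    ⟨⟨le_rfl, by linarith⟩, h2.le, h4.le⟩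
  refine ⟨(X, W), hzs, ?_, ?_, seg_split (convex_rc _ _ _ _) (convex_rc _ _ _ _) hp hq hzA hzB hzs,
    ?_, ?_⟩
  · rw [(closed_rc _ _ _ _).frontier_eq, interior_rc]
    exact ⟨hzA, fun h => lt_irrefl _ h.1.2⟩
  · rw [(closed_rc _ _ _ _).frontier_eq, interior_rc]
    exact ⟨hzB, fun h => lt_irrefl _ h.1.1⟩
  · refine mem_interior.2 ⟨Ioo l1 r2 ×ˢ Ioo (max b1 b2) (min t1 t2), ?_, isOpen_Ioo.prod isOpen_Ioo,
      ⟨⟨by linarith, by linarith⟩, max_lt h1 h2, lt_min h3 h4⟩⟩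
    rintro ⟨u, v⟩ ⟨⟨a1, a2⟩, a3, a4⟩
    simp only [max_lt_iff, lt_min_iff] at a1 a2 a3 a4
    rcases le_total u X with h | h
    · exact Or.inl ⟨⟨a1.le, h⟩, a3.1.le, a4.1.le⟩
    · exact Or.inr ⟨⟨h, a2.le⟩, a3.2.le, a4.2.le⟩
  · refine mem_intrinsic _ (univ ×ˢ Ioo (max b1 b2) (min t1 t2))
      (LinearMap.fst ℝ ℝ ℝ).toAffineMap X ?_ (isOpen_univ.prod isOpen_Ioo) _ ⟨hzA, hzB⟩
      ⟨mem_univ _, max_lt h1 h2, lt_min h3 h4⟩ ?_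
    · rintro ⟨u, v⟩ ⟨⟨⟨-, a1⟩, -⟩, ⟨a2, -⟩, -⟩
      exact le_antisymm a1 a2
    · rintro ⟨u, v⟩ ⟨-, a3, a4⟩ h
      simp only [max_lt_iff, lt_min_iff] at a3 a4
      have h : u = X := h
      subst h
      exact ⟨⟨⟨by linarith, le_rfl⟩, a3.1.le, a4.1.le⟩, ⟨le_rfl, by linarith⟩, a3.2.le, a4.2.le⟩

theorem edgeH {b1 X l1 r1 t2 l2 r2 x1 y1 x2 y2 : ℝ}
    (hp : (x1, y1) ∈ interior (Icc l1 r1 ×ˢ Icc b1 X : Set (ℝ × ℝ)))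
    (hq : (x2, y2) ∈ interior (Icc l2 r2 ×ˢ Icc X t2 : Set (ℝ × ℝ)))
    (h1 : l1 < x1 + (x2 - x1) * ((X - y1) / (y2 - y1)))
    (h2 : l2 < x1 + (x2 - x1) * ((X - y1) / (y2 - y1)))
    (h3 : x1 + (x2 - x1) * ((X - y1) / (y2 - y1)) < r1)
    (h4 : x1 + (x2 - x1) * ((X - y1) / (y2 - y1)) < r2) :
    EdgeP (Icc l1 r1 ×ˢ Icc b1 X) (Icc l2 r2 ×ˢ Icc X t2) (x1, y1) (x2, y2) := by
  have hp' := hp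
  have hq' := hq
  rw [interior_rc] at hp' hq'
  obtain ⟨⟨p3, p4⟩, p1, p2⟩ := hp'
  obtain ⟨⟨q3, q4⟩, q1, q2⟩ := hq'
  simp only at p1 p2 p3 p4 q1 q2 q3 q4
  have hx : 0 < y2 - y1 := by linarith
  obtain ⟨τ, hτ⟩ : ∃ τ, τ = (X - y1) / (y2 - y1) := ⟨_, rfl⟩
  rw [← hτ] at h1 h2 h3 h4
  obtain ⟨W, hW⟩ : ∃ W, W = x1 + (x2 - x1) * τ := ⟨_, rfl⟩
  rw [← hW] at h1 h2 h3 h4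
  have hτ0 : 0 ≤ τ := by rw [hτ]; exact div_nonneg (by linarith) hx.le
  have hτ1 : τ ≤ 1 := by rw [hτ, div_le_one hx]; linarith
  have hτX : τ * (y2 - y1) = X - y1 := by rw [hτ, div_mul_cancel₀ _ hx.ne']
  have hzs : (W, X) ∈ segment ℝ (x1, y1) (x2, y2) := by
    refine ⟨1 - τ, τ, by linarith, hτ0, by ring, ?_⟩
    ext
    · simp; linarith
    · simp; linarith
  have hzA : (W, X) ∈ (Icc l1 r1 ×ˢ Icc b1 X : Set (ℝ × ℝ)) :=
    ⟨⟨h1.le, h3.le⟩, by linarith, le_rfl⟩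
  have hzB : (W, X) ∈ (Icc l2 r2 ×ˢ Icc X t2 : Set (ℝ × ℝ)) :=
    ⟨⟨h2.le, h4.le⟩, le_rfl, by linarith⟩
  refine ⟨(W, X), hzs, ?_, ?_, seg_split (convex_rc _ _ _ _) (convex_rc _ _ _ _) hp hq hzA hzB hzs,
    ?_, ?_⟩
  · rw [(closed_rc _ _ _ _).frontier_eq, interior_rc]
    exact ⟨hzA, fun h => lt_irrefl _ h.2.2⟩
  · rw [(closed_rc _ _ _ _).frontier_eq, interior_rc]
    exact ⟨hzB, fun h => lt_irrefl _ h.2.1⟩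
  · refine mem_interior.2 ⟨Ioo (max l1 l2) (min r1 r2) ×ˢ Ioo b1 t2, ?_, isOpen_Ioo.prod isOpen_Ioo,
      ⟨⟨max_lt h1 h2, lt_min h3 h4⟩, by linarith, by linarith⟩⟩
    rintro ⟨u, v⟩ ⟨⟨a3, a4⟩, a1, a2⟩
    simp only [max_lt_iff, lt_min_iff] at a1 a2 a3 a4
    rcases le_total v X with h | h
    · exact Or.inl ⟨⟨a3.1.le, a4.1.le⟩, a1.le, h⟩
    · exact Or.inr ⟨⟨a3.2.le, a4.2.le⟩, h, a2.le⟩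
  · refine mem_intrinsic _ (Ioo (max l1 l2) (min r1 r2) ×ˢ univ)
      (LinearMap.snd ℝ ℝ ℝ).toAffineMap X ?_ (isOpen_Ioo.prod isOpen_univ) _ ⟨hzA, hzB⟩
      ⟨⟨max_lt h1 h2, lt_min h3 h4⟩, mem_univ _⟩ ?_
    · rintro ⟨u, v⟩ ⟨⟨-, -, a1⟩, -, a2, -⟩
      exact le_antisymm a1 a2
    · rintro ⟨u, v⟩ ⟨⟨a3, a4⟩, -⟩ h
      simp only [max_lt_iff, lt_min_iff] at a3 a4
      have h : v = X := h
      subst h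
      exact ⟨⟨⟨a3.1.le, a4.1.le⟩, by linarith, le_rfl⟩, ⟨a3.2.le, a4.2.le⟩, le_rfl, by linarith⟩

theorem drawing_of_edges {V : Type*} [Fintype V] (G : SimpleGraph V) (R : V → Set (ℝ × ℝ))
    (φ : V → ℝ × ℝ) (hinter : ∀ v, φ v ∈ interior (R v)) (hconv : ∀ v, Convex ℝ (R v))
    (hcl : ∀ v, IsClosed (R v)) (hcli : ∀ v, R v ⊆ closure (interior (R v)))
    (hdisj : ∀ u v, u ≠ v → interior (R u) ∩ interior (R v) = ∅)
    (hE : ∀ u v, G.Adj u v → EdgeP (R u) (R v) (φ u) (φ v)) :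
    HasStraightLineSimultaneousDrawing G R := by
  have meet : ∀ u w p, p ∈ interior (R u) → p ∈ R w → w = u := by
    intro u w p h1 h2
    by_contra hne
    obtain ⟨q, hq1, hq2⟩ := mem_closure_iff.1 (hcli w h2) _ isOpen_interior h1
    have : q ∈ interior (R w) ∩ interior (R u) := ⟨hq2, hq1⟩
    rw [hdisj w u hne] at this
    exact this
  have frin : ∀ u w p, p ∈ interior (R u) → p ∉ frontier (R w) := by
    intro u w p h1 h2
    have h3 := meet u w p h1 ((hcl w).frontier_subset h2)
    subst h3
    exact h2.2 h1
  choose z hz1 hz2 hz3 hz4 hz5 hz6 using hE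
  have onfr : ∀ u v (h : G.Adj u v) p w, p ∈ segment ℝ (φ u) (φ v) → p ∈ frontier (R w) →
      p = z u v h := by
    intro u v h p w hp hw
    rcases hz4 u v h p hp with h1 | h1 | h1
    · exact h1
    · exact absurd hw (frin _ _ _ h1)
    · exact absurd hw (frin _ _ _ h1)
  -- crossing points determine the edge
  have zin : ∀ u v (h : G.Adj u v) a, z u v h ∈ R a → a = u ∨ a = v := by
    intro u v h a ha
    obtain ⟨q, hq1, hq2⟩ := mem_closure_iff.1 (hcli a ha) _ isOpen_interior (hz5 u v h)
    rcases interior_subset hq1 with h1 | h1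
    · exact Or.inl (meet a u q hq2 h1).symm
    · exact Or.inr (meet a v q hq2 h1).symm
  have zinj : ∀ u v (h : G.Adj u v) a b (h' : G.Adj a b), z u v h = z a b h' →
      s(u, v) = s(a, b) := by
    intro u v h a b h' he
    have h1 := zin u v h a (he ▸ (hcl a).frontier_subset (hz2 a b h'))
    have h2 := zin u v h b (he ▸ (hcl b).frontier_subset (hz3 a b h'))
    have h3 := h'.ne
    rw [Sym2.eq_iff]
    rcases h1 with h1 | h1 <;> rcases h2 with h2 | h2
    · exact absurd (h1.trans h2.symm) h3
    · exact Or.inl ⟨h1.symm, h2.symm⟩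
    · exact Or.inr ⟨h2.symm, h1.symm⟩
    · exact absurd (h1.trans h2.symm) h3
  have zsymm : ∀ u v (h : G.Adj u v), z v u h.symm = z u v h := fun u v h =>
    onfr u v h _ v (segment_symm ℝ (φ v) (φ u) ▸ hz1 v u h.symm) (hz2 v u h.symm)
  -- two edges at a common endpoint
  have common : ∀ u v b (h : G.Adj u v) (h' : G.Adj u b) p, p ∈ segment ℝ (φ u) (φ v) →
      p ∈ segment ℝ (φ u) (φ b) → p ≠ φ u → z u v h = z u b h' := by
    intro u v b h h' p hp hp' hne
    have ray : ∀ v (h : G.Adj u v), p ∈ segment ℝ (φ u) (φ v) →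
        ∃ c : ℝ, 0 < c ∧ z u v h = φ u + c • (p - φ u) := by
      intro v h hp
      have hz := hz1 u v h
      rw [segment_eq_image'] at hp hz
      obtain ⟨τ, hτ, rfl⟩ := hp
      obtain ⟨σ, hσ, hσz⟩ := hz
      have hτ0 : τ ≠ 0 := by
        rintro rfl
        simp at hne
      have hσ0 : σ ≠ 0 := by
        rintro rfl
        have : z u v h = φ u := by rw [← hσz]; simp
        exact frin u u _ (hinter u) (this ▸ hz2 u v h)
      have hτp : 0 < τ := lt_of_le_of_ne hτ.1 hτ0.symm
      have hσp : 0 < σ := lt_of_le_of_ne hσ.1 hσ0.symm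
      refine ⟨σ / τ, by positivity, ?_⟩
      rw [← hσz]
      simp only [add_sub_cancel_left, smul_smul]
      rw [div_mul_cancel₀ _ hτ0]
    have noLt : ∀ v b (h : G.Adj u v) (h' : G.Adj u b) (c d : ℝ), 0 < c → c < d →
        z u v h = φ u + c • (p - φ u) → z u b h' = φ u + d • (p - φ u) → False := by
      intro v b h h' c d hc hcd e1 e2
      have hd : 0 < d := hc.trans hcd
      have := (hconv u).combo_interior_self_mem_interior (hinter u)
        ((hcl u).frontier_subset (hz2 u b h')) (a := 1 - c / d) (b := c / d)
        (by rw [sub_pos, div_lt_one hd]; exact hcd) (by positivity) (by ring)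
      apply frin u u _ this
      convert hz2 u v h using 1
      rw [e1, e2, smul_add, smul_smul, div_mul_cancel₀ _ hd.ne', ← add_assoc, ← add_smul]
      simp
    obtain ⟨c, hc, e1⟩ := ray v h hp
    obtain ⟨d, hd, e2⟩ := ray b h' hp'
    rcases lt_trichotomy c d with hcd | hcd | hcd
    · exact (noLt v b h h' c d hc hcd e1 e2).elim
    · rw [e1, e2, hcd]
    · exact (noLt b v h' h d c hd hcd e2 e1).elim
  refine ⟨φ, ?_, hinter, ?_, ?_⟩
  · intro u v huv
    exact (meet u v (φ u) (hinter u) (huv ▸ interior_subset (hinter v))).symm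
  · intro u v h
    refine ⟨z u v h, ?_, hz6 u v h⟩
    apply Subset.antisymm
    · rintro p ⟨hp, hp'⟩
      obtain ⟨w, hw⟩ := mem_iUnion.1 hp'
      exact onfr u v h p w hp hw
    · rintro p rfl
      exact ⟨hz1 u v h, mem_iUnion.2 ⟨u, hz2 u v h⟩⟩
  · intro u v a b h h' hne p ⟨hp, hp'⟩
    have core : ∀ u v a b (h : G.Adj u v) (h' : G.Adj a b), s(u, v) ≠ s(a, b) →
        p ∈ segment ℝ (φ u) (φ v) → p ∈ segment ℝ (φ a) (φ b) → p ∈ interior (R u) →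
        p ∈ interior (R a) → u = a ∧ p = φ u := by
      intro u v a b h h' hne hp hp' h1 h2
      have hua := meet a u p h2 (interior_subset h1)
      subst hua
      refine ⟨rfl, ?_⟩
      by_contra hpu
      exact hne (zinj _ _ _ _ _ _ (common u v b h h' p hp hp' hpu))
    have sw : ∀ {u v : V}, p ∈ segment ℝ (φ u) (φ v) → p ∈ segment ℝ (φ v) (φ u) :=
      fun h => segment_symm ℝ (φ _) (φ _) ▸ h
    rcases hz4 u v h p hp with h1 | h1 | h1
    · exact absurd (zinj u v h a b h'
        (h1 ▸ onfr a b h' p u hp' (h1 ▸ hz2 u v h))) hne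
    · rcases hz4 a b h' p hp' with h2 | h2 | h2
      · exact absurd (h2 ▸ hz2 a b h') (frin u a p h1)
      · obtain ⟨e1, e2⟩ := core u v a b h h' hne hp hp' h1 h2
        exact ⟨u, ⟨by simp, by simp [e1]⟩, e2.symm⟩
      · obtain ⟨e1, e2⟩ := core u v b a h h'.symm (by rwa [Sym2.eq_swap (a := b)]) hp (sw hp') h1 h2
        exact ⟨u, ⟨by simp, by simp [e1]⟩, e2.symm⟩
    · rcases hz4 a b h' p hp' with h2 | h2 | h2
      · exact absurd (h2 ▸ hz2 a b h') (frin v a p h1)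
      · obtain ⟨e1, e2⟩ := core v u a b h.symm h' (by rwa [Sym2.eq_swap (a := v)]) (sw hp) hp' h1 h2
        exact ⟨v, ⟨by simp, by simp [e1]⟩, e2.symm⟩
      · obtain ⟨e1, e2⟩ := core v u b a h.symm h'.symm
          (by rwa [Sym2.eq_swap (a := v), Sym2.eq_swap (a := b)]) (sw hp) (sw hp') h1 h2
        exact ⟨v, ⟨by simp, by simp [e1]⟩, e2.symm⟩

theorem Tl.ofDual {V : Type*} [Fintype V] {G : SimpleGraph V} {ρ : V → Set (ℝ × ℝ)}
    (hρ : IsRectangularDual G ρ) :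
    ∃ T : Tl V, ∀ v, ρ v = Icc (T.e v false) (T.e v true) ×ˢ Icc (T.b v) (T.t v) := by
  choose l r b t hlr hbt hR using hρ.rect
  obtain ⟨X0, X1, Y0, Y1, hX, hY, hU⟩ := hρ.union_rect
  have hin : ∀ v p q, l v ≤ p → p ≤ r v → b v ≤ q → q ≤ t v →
      X0 ≤ p ∧ p ≤ X1 ∧ Y0 ≤ q ∧ q ≤ Y1 := by
    intro v p q h1 h2 h3 h4
    have h5 : (p, q) ∈ ⋃ v, ρ v := by
      refine mem_iUnion.2 ⟨v, ?_⟩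
      rw [hR v]
      exact ⟨⟨h1, h2⟩, h3, h4⟩
    rw [hU] at h5
    exact ⟨h5.1.1, h5.1.2, h5.2.1, h5.2.2⟩
  refine ⟨⟨fun v i => if i then r v else l v, b, t, X0, X1, Y0, Y1, hX, hY, ?_, hbt, ?_, ?_, ?_,
    ?_, ?_, ?_⟩, ?_⟩
  · intro v; simpa using hlr v
  · intro u v hne h1 h2 h3 h4
    simp only [if_true, Bool.false_eq_true, if_false] at h1 h2
    have h := hρ.disjoint_interiors u v hne
    rw [hR u, hR v, interior_rc, interior_rc] at h
    have k1 : max (l u) (l v) < min (r u) (r v) :=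
      max_lt (lt_min (hlr u) h1) (lt_min h2 (hlr v))
    have k2 : max (b u) (b v) < min (t u) (t v) :=
      max_lt (lt_min (hbt u) h3) (lt_min h4 (hbt v))
    obtain ⟨p, hp1, hp2⟩ := exists_between k1
    obtain ⟨q, hq1, hq2⟩ := exists_between k2
    rw [max_lt_iff] at hp1 hq1
    rw [lt_min_iff] at hp2 hq2
    have : (p, q) ∈ Ioo (l u) (r u) ×ˢ Ioo (b u) (t u) ∩ Ioo (l v) (r v) ×ˢ Ioo (b v) (t v) :=
      ⟨⟨⟨hp1.1, hp2.1⟩, hq1.1, hq2.1⟩, ⟨hp1.2, hp2.2⟩, hq1.2, hq2.2⟩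
    rw [h] at this
    exact this
  · intro v
    simpa using (hin v (l v) (b v) le_rfl (hlr v).le le_rfl (hbt v).le).1
  · intro v
    simpa using (hin v (r v) (b v) (hlr v).le le_rfl le_rfl (hbt v).le).2.1
  · intro v
    exact (hin v (r v) (b v) (hlr v).le le_rfl le_rfl (hbt v).le).2.2.1
  · intro v
    exact (hin v (r v) (t v) (hlr v).le le_rfl (hbt v).le le_rfl).2.2.2
  · intro p q h1 h2 h3 h4
    have h5 : (p, q) ∈ ⋃ v, ρ v := by
      rw [hU]
      exact ⟨⟨h1, h2⟩, h3, h4⟩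
    obtain ⟨v, hv⟩ := mem_iUnion.1 h5
    rw [hR v] at hv
    exact ⟨v, by simpa using hv.1.1, by simpa using hv.1.2, hv.2.1, hv.2.2⟩
  · intro v
    simpa using hR v

section final
variable {V : Type*} [Fintype V] {T : Tl V} {Y : ℝ → ℝ} {e' : V → Bool → ℝ} {x y : V → ℝ}

theorem Good.Ylt (g : Good T T.lev Y e' x y) {c d : ℝ} (hc : c ∈ T.lev) (hd : d ∈ T.lev) :
    Y c < Y d ↔ c < d := by
  refine ⟨fun h => ?_, g.Ym c hc d hd⟩
  by_contra h'
  rcases (not_lt.1 h').lt_or_eq with h1 | h1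
  · exact lt_asymm h (g.Ym d hd c hc h1)
  · rw [h1] at h; exact lt_irrefl _ h

theorem Good.Yle (g : Good T T.lev Y e' x y) {c d : ℝ} (hc : c ∈ T.lev) (hd : d ∈ T.lev) :
    Y c ≤ Y d ↔ c ≤ d := by
  rw [← not_lt, g.Ylt hd hc, not_lt]

theorem Good.elt (g : Good T T.lev Y e' x y) {u w : V} (i k : Bool) (h1 : T.b u ≤ T.t w)
    (h2 : T.b w ≤ T.t u) : e' u i < e' w k ↔ T.e u i < T.e w k := by
  refine ⟨fun h => ?_, g.ord u w i k (T.b_lev u) (T.b_lev w) h1 h2⟩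
  by_contra h'
  rcases (not_lt.1 h').lt_or_eq with h3 | h3
  · exact lt_asymm h (g.ord w u k i (T.b_lev w) (T.b_lev u) h2 h1 h3)
  · exact h.ne (g.ordeq w u k i (T.b_lev w) (T.b_lev u) h2 h1 h3).symm

theorem Good.ele (g : Good T T.lev Y e' x y) {u w : V} (i k : Bool) (h1 : T.b u ≤ T.t w)
    (h2 : T.b w ≤ T.t u) : e' u i ≤ e' w k ↔ T.e u i ≤ T.e w k := by
  rw [← not_lt, g.elt k i h2 h1, not_lt]

theorem Good.lr' (g : Good T T.lev Y e' x y) (v : V) : e' v false < e' v true :=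
  (g.xlo v (T.b_lev v)).trans (g.xhi v (T.b_lev v))

theorem Good.bt' (g : Good T T.lev Y e' x y) (v : V) : Y (T.b v) < Y (T.t v) :=
  g.Ym _ (T.b_lev v) _ (T.t_lev v) (T.bt v)

theorem Good.disj' (g : Good T T.lev Y e' x y) (u v : V) (hne : u ≠ v) :
    interior (Icc (e' u false) (e' u true) ×ˢ Icc (Y (T.b u)) (Y (T.t u)) : Set (ℝ × ℝ)) ∩
    interior (Icc (e' v false) (e' v true) ×ˢ Icc (Y (T.b v)) (Y (T.t v)) : Set (ℝ × ℝ)) = ∅ := by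
  rw [interior_rc, interior_rc, Set.eq_empty_iff_forall_notMem]
  rintro ⟨p, q⟩ ⟨⟨⟨h1, h2⟩, h3, h4⟩, ⟨h5, h6⟩, h7, h8⟩
  simp only at h1 h2 h3 h4 h5 h6 h7 h8
  have k1 := (g.Ylt (T.b_lev u) (T.t_lev v)).1 (h3.trans h8)
  have k2 := (g.Ylt (T.b_lev v) (T.t_lev u)).1 (h7.trans h4)
  exact T.disj u v hne ((g.elt _ _ k1.le k2.le).1 (h1.trans h6))
    ((g.elt _ _ k2.le k1.le).1 (h5.trans h2)) k1 k2

theorem Tl.Y0_lev (T : Tl V) : T.Y0 ∈ T.lev := by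
  obtain ⟨v, -, -, h, -⟩ := T.cover T.X0 T.Y0 le_rfl T.X01.le le_rfl T.Y01.le
  rw [← le_antisymm h (T.inb v)]
  exact T.b_lev v

theorem Tl.Y1_lev (T : Tl V) : T.Y1 ∈ T.lev := by
  obtain ⟨v, -, -, -, h⟩ := T.cover T.X0 T.Y1 le_rfl T.X01.le T.Y01.le le_rfl
  rw [le_antisymm h (T.intop v)]
  exact T.t_lev v

theorem Good.cover' (g : Good T T.lev Y e' x y) (p q : ℝ) (hp0 : 0 ≤ p) (hp1 : p ≤ 1)
    (hq0 : Y T.Y0 ≤ q) (hq1 : q ≤ Y T.Y1) :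
    ∃ v, e' v false ≤ p ∧ p ≤ e' v true ∧ Y (T.b v) ≤ q ∧ q ≤ Y (T.t v) := by
  classical
  -- a height `q0` in the original tiling
  obtain ⟨q0, hq00, hq01, hb, ht⟩ : ∃ q0, T.Y0 ≤ q0 ∧ q0 ≤ T.Y1 ∧
      (∀ c ∈ T.lev, c ≤ q0 → Y c ≤ q) ∧ (∀ c ∈ T.lev, q0 ≤ c → q ≤ Y c) := by
    obtain ⟨c, hc, hmax⟩ := (T.lev.filter fun c => Y c ≤ q).exists_max_image id
      ⟨T.Y0, by simp [T.Y0_lev, hq0]⟩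
    simp only [Finset.mem_filter, id] at hc hmax
    have hmono : ∀ d ∈ T.lev, d ≤ c → Y d ≤ q := fun d hd h => ((g.Yle hd hc.1).2 h).trans hc.2
    have hbig : ∀ d ∈ T.lev, c < d → q ≤ Y d := by
      intro d hd h
      by_contra h'
      exact absurd (hmax d ⟨hd, (not_le.1 h').le⟩) (not_le.2 h)
    have hbd := T.lev_bd c hc.1
    rcases hbd.2.lt_or_eq with h | h
    · obtain ⟨q0, h1, h2, h3⟩ := exists_gap T.lev c T.Y1 h
      refine ⟨q0, hbd.1.trans h1.le, h2.le, fun d hd hdq => hmono d hd ?_,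
        fun d hd hdq => hbig d hd (h1.trans_le hdq)⟩
      by_contra h'
      exact absurd (h3 d hd (not_le.1 h')) (not_lt.2 hdq)
    · refine ⟨c, hbd.1, hbd.2, hmono, fun d hd hdq => ?_⟩
      have : d = T.Y1 := le_antisymm (T.lev_bd d hd).2 (h ▸ hdq)
      rw [this]; exact hq1
  let row : Finset V := Finset.univ.filter fun v => T.b v ≤ q0 ∧ q0 ≤ T.t v ∧ e' v false ≤ p
  have hrow : row.Nonempty := by
    obtain ⟨v, h1, h2, h3, h4⟩ := T.cover T.X0 q0 le_rfl T.X01.le hq00 hq01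
    refine ⟨v, ?_⟩
    simp only [row, Finset.mem_filter, Finset.mem_univ, true_and]
    refine ⟨h3, h4, ?_⟩
    rw [g.eq0 v false (T.b_lev v) (le_antisymm h1 (T.inl v))]
    exact hp0
  obtain ⟨u, hu, hmax⟩ := row.exists_max_image (fun v => e' v true) hrow
  simp only [row, Finset.mem_filter, Finset.mem_univ, true_and] at hu hmax
  obtain ⟨hu1, hu2, hu3⟩ := hu
  refine ⟨u, hu3, ?_, hb _ (T.b_lev u) hu1, ht _ (T.t_lev u) hu2⟩
  by_contra hlt
  rw [not_le] at hlt
  have hX : T.e u true < T.X1 := by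
    refine (T.inr u).lt_of_ne fun h => ?_
    have := g.eq1 u true (T.b_lev u) h
    linarith
  obtain ⟨p0, h1, h2, h3⟩ := exists_gap (Finset.univ.image fun v => T.e v false) _ _ hX
  obtain ⟨w, w1, w2, w3, w4⟩ := T.cover p0 q0 ((T.inX0 u true).trans h1.le) h2.le hq00 hq01
  have w5 : T.e w false ≤ T.e u true := by
    by_contra h'
    have := h3 _ (Finset.mem_image_of_mem _ (Finset.mem_univ w)) (not_le.1 h')
    linarith
  have k1 : T.b w ≤ T.t u := w3.trans hu2
  have k2 : T.b u ≤ T.t w := hu1.trans w4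
  have w6 := (g.ele false true k1 k2).2 w5
  have w7 := (g.elt true true k2 k1).2 (h1.trans_le w2)
  exact absurd (hmax w ⟨w3, w4, w6.trans hlt.le⟩) (not_le.2 w7)

theorem Good.two (g : Good T T.lev Y e' x y) (u v : V) :
    HasTwoPoints ((Icc (e' u false) (e' u true) ×ˢ Icc (Y (T.b u)) (Y (T.t u))) ∩
      (Icc (e' v false) (e' v true) ×ˢ Icc (Y (T.b v)) (Y (T.t v)))) ↔
    HasTwoPoints ((Icc (T.e u false) (T.e u true) ×ˢ Icc (T.b u) (T.t u)) ∩
      (Icc (T.e v false) (T.e v true) ×ˢ Icc (T.b v) (T.t v))) := by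
  rw [twoPts (g.lr' u) (g.bt' u) (g.lr' v) (g.bt' v), twoPts (T.lr u) (T.bt u) (T.lr v) (T.bt v)]
  rw [g.Yle (T.b_lev u) (T.t_lev v), g.Yle (T.b_lev v) (T.t_lev u),
    g.Ylt (T.b_lev u) (T.t_lev v), g.Ylt (T.b_lev v) (T.t_lev u)]
  by_cases h : T.b u ≤ T.t v ∧ T.b v ≤ T.t u
  · rw [g.ele _ _ h.1 h.2, g.ele _ _ h.2 h.1, g.elt _ _ h.1 h.2, g.elt _ _ h.2 h.1]
  · constructor
    · rintro ⟨-, -, h1, h2, -⟩; exact absurd ⟨h1, h2⟩ h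
    · rintro ⟨-, -, h1, h2, -⟩; exact absurd ⟨h1, h2⟩ h

theorem Good.dual (g : Good T T.lev Y e' x y) {G : SimpleGraph V}
    (hρ : IsRectangularDual G
      fun v => Icc (T.e v false) (T.e v true) ×ˢ Icc (T.b v) (T.t v)) :
    IsRectangularDual G
      fun v => Icc (e' v false) (e' v true) ×ˢ Icc (Y (T.b v)) (Y (T.t v)) where
  rect v := ⟨_, _, _, _, g.lr' v, g.bt' v, rfl⟩
  disjoint_interiors := g.disj'
  union_rect := by
    refine ⟨0, 1, Y T.Y0, Y T.Y1, zero_lt_one, (g.Ylt T.Y0_lev T.Y1_lev).2 T.Y01, ?_⟩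
    ext ⟨p, q⟩
    simp only [mem_iUnion, mem_prod, mem_Icc]
    constructor
    · rintro ⟨v, ⟨h1, h2⟩, h3, h4⟩
      exact ⟨⟨(g.bd0 v false (T.b_lev v)).trans h1, h2.trans (g.bd1 v true (T.b_lev v))⟩,
        ((g.Yle T.Y0_lev (T.b_lev v)).2 (T.inb v)).trans h3,
        h4.trans ((g.Yle (T.t_lev v) T.Y1_lev).2 (T.intop v))⟩
    · rintro ⟨⟨h1, h2⟩, h3, h4⟩
      obtain ⟨v, k1, k2, k3, k4⟩ := g.cover' p q h1 h2 h3 h4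
      exact ⟨v, ⟨k1, k2⟩, k3, k4⟩
  no_four_meet := by
    rintro ⟨p, q⟩
    set S := {v : V | (p, q) ∈
      (Icc (e' v false) (e' v true) ×ˢ Icc (Y (T.b v)) (Y (T.t v)) : Set (ℝ × ℝ))} with hS
    rcases S.eq_empty_or_nonempty with h | h
    · simp [h]
    have hfin : S.Finite := Set.toFinite _
    obtain ⟨v1, hv1, hm1⟩ := Set.exists_max_image S (fun v => T.e v false) hfin h
    obtain ⟨v2, hv2, hm2⟩ := Set.exists_max_image S T.b hfin h
    have hbt : ∀ u ∈ S, ∀ w ∈ S, T.b u ≤ T.t w := fun u hu w hw =>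
      (g.Yle (T.b_lev u) (T.t_lev w)).1 (hu.2.1.trans hw.2.2)
    refine le_trans (Set.ncard_le_ncard ?_ (Set.toFinite _))
      (hρ.no_four_meet (T.e v1 false, T.b v2))
    intro w hw
    exact ⟨⟨hm1 w hw, (g.ele _ _ (hbt v1 hv1 w hw) (hbt w hw v1 hv1)).1 (hv1.1.1.trans hw.1.2)⟩,
      hm2 w hw, hbt v2 hv2 w hw⟩
  adj_iff u v hne := (hρ.adj_iff u v hne).trans (g.two u v).symm

theorem Good.edge (g : Good T T.lev Y e' x y) (hinter : ∀ v, (x v, y v) ∈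
      interior (Icc (e' v false) (e' v true) ×ˢ Icc (Y (T.b v)) (Y (T.t v)) : Set (ℝ × ℝ)))
    (u v : V) (hne : u ≠ v)
    (h : HasTwoPoints ((Icc (T.e u false) (T.e u true) ×ˢ Icc (T.b u) (T.t u)) ∩
      (Icc (T.e v false) (T.e v true) ×ˢ Icc (T.b v) (T.t v)))) :
    EdgeP (Icc (e' u false) (e' u true) ×ˢ Icc (Y (T.b u)) (Y (T.t u)))
      (Icc (e' v false) (e' v true) ×ˢ Icc (Y (T.b v)) (Y (T.t v))) (x u, y u) (x v, y v) := by
  have V1 : ∀ u v, T.e u true = T.e v false → T.b u < T.t v → T.b v < T.t u →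
      EdgeP (Icc (e' u false) (e' u true) ×ˢ Icc (Y (T.b u)) (Y (T.t u)))
      (Icc (e' v false) (e' v true) ×ˢ Icc (Y (T.b v)) (Y (T.t v))) (x u, y u) (x v, y v) := by
    intro u v he h1 h2
    have heq := g.ordeq u v true false (T.b_lev u) (T.b_lev v) h1.le h2.le he
    obtain ⟨c1, c2⟩ := g.vc u v (T.b_lev u) (T.b_lev v) he h1 h2
    have hp := hinter u
    have hq := hinter v
    have a1 := g.xhi u (T.b_lev u)
    have a2 := g.xlo v (T.b_lev v)
    rw [← heq] at hq a2 ⊢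
    have m1 := g.yhi u (T.b_lev u) _ (T.t_lev u) (T.bt u)
    have m2 := g.yhi u (T.b_lev u) _ (T.t_lev v) h1
    have m3 := g.yhi v (T.b_lev v) _ (T.t_lev v) (T.bt v)
    have m4 := g.yhi v (T.b_lev v) _ (T.t_lev u) h2
    have k0 : 0 ≤ (e' u true - x u) / (x v - x u) := div_nonneg (by linarith) (by linarith)
    have k1 : (e' u true - x u) / (x v - x u) ≤ 1 := by
      rw [div_le_one (by linarith)]; linarith
    have key : ∀ c, y u < c → y v < c →
        y u + (y v - y u) * ((e' u true - x u) / (x v - x u)) < c := by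
      intro c hc1 hc2
      generalize (e' u true - x u) / (x v - x u) = s at k0 k1
      rcases le_total (y u) (y v) with h | h
      · nlinarith [mul_nonneg (sub_nonneg.2 h) (sub_nonneg.2 k1)]
      · nlinarith [mul_nonneg (sub_nonneg.2 h) k0]
    exact edgeV hp hq c1 c2 (key _ m1 m4) (key _ m2 m3)
  have H1 : ∀ u v, T.t u = T.b v → T.e u false < T.e v true → T.e v false < T.e u true →
      EdgeP (Icc (e' u false) (e' u true) ×ˢ Icc (Y (T.b u)) (Y (T.t u)))
      (Icc (e' v false) (e' v true) ×ˢ Icc (Y (T.b v)) (Y (T.t v))) (x u, y u) (x v, y v) := by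
    intro u v he h1 h2
    obtain ⟨c1, c2, c3, c4⟩ := g.hc u v (T.b_lev u) (T.b_lev v) he h1 h2
    have hp := hinter u
    have hq := hinter v
    rw [← he] at hq ⊢
    exact edgeH hp hq c1 c3 c2 c4
  rw [twoPts (T.lr u) (T.bt u) (T.lr v) (T.bt v)] at h
  obtain ⟨a1, a2, a3, a4, ⟨h1, h2⟩ | ⟨h1, h2⟩⟩ := h
  · rcases a3.lt_or_eq with a3 | a3
    · rcases a4.lt_or_eq with a4 | a4
      · exact (T.disj u v hne h1 h2 a3 a4).elim
      · exact H1 u v a4.symm h1 h2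
    · exact (H1 v u a3.symm h2 h1).symm
  · rcases a1.lt_or_eq with a1 | a1
    · rcases a2.lt_or_eq with a2 | a2
      · exact (T.disj u v hne a1 a2 h1 h2).elim
      · exact V1 u v a2.symm h1 h2
    · exact (V1 v u a1.symm h2 h1).symm

end final

/-- Main theorem: a rectangular dual can be rescaled so that the primal graph and the
rescaled dual admit a straight-line simultaneous drawing. -/
theorem exists_scaling_with_straightline_simultaneous_drawing
    {V : Type*} [Fintype V] (G : SimpleGraph V) (ρ : V → Set (ℝ × ℝ))
    (hρ : IsRectangularDual G ρ) :
    ∃ ρ' : V → Set (ℝ × ℝ), IsScaling G ρ ρ' ∧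
      HasStraightLineSimultaneousDrawing G ρ' := by
  obtain ⟨T, hT⟩ := Tl.ofDual hρ
  obtain rfl : ρ = fun v => Icc (T.e v false) (T.e v true) ×ˢ Icc (T.b v) (T.t v) := funext hT
  obtain ⟨Y, e', x, y, g⟩ := Good.exists T
  have hinter : ∀ v, (x v, y v) ∈
      interior (Icc (e' v false) (e' v true) ×ˢ Icc (Y (T.b v)) (Y (T.t v)) : Set (ℝ × ℝ)) := by
    intro v
    rw [interior_rc]
    exact ⟨⟨g.xlo v (T.b_lev v), g.xhi v (T.b_lev v)⟩, g.ylo v (T.b_lev v),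
      g.yhi v (T.b_lev v) _ (T.t_lev v) (T.bt v)⟩
  refine ⟨fun v => Icc (e' v false) (e' v true) ×ˢ Icc (Y (T.b v)) (Y (T.t v)),
    ⟨g.dual hρ, ?_⟩, ?_⟩
  · intro u v hadj
    have h := (hρ.adj_iff u v hadj.ne).1 hadj
    rw [twoPts (T.lr u) (T.bt u) (T.lr v) (T.bt v)] at h
    obtain ⟨a1, a2, a3, a4, -⟩ := h
    rw [vertSeg (T.lr u) (T.bt u) (T.lr v) (T.bt v) a1 a2 a3 a4,
      vertSeg (g.lr' u) (g.bt' u) (g.lr' v) (g.bt' v) ((g.ele _ _ a3 a4).2 a1)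
        ((g.ele _ _ a4 a3).2 a2) ((g.Yle (T.b_lev u) (T.t_lev v)).2 a3)
        ((g.Yle (T.b_lev v) (T.t_lev u)).2 a4), g.elt _ _ a3 a4, g.elt _ _ a4 a3]
  · refine drawing_of_edges G _ (fun v => (x v, y v)) hinter (fun v => convex_rc _ _ _ _)
      (fun v => closed_rc _ _ _ _) (fun v => ?_) g.disj' fun u v hadj =>
        g.edge hinter u v hadj.ne ((hρ.adj_iff u v hadj.ne).1 hadj)
    show _ ⊆ closure (interior (Icc (e' v false) (e' v true) ×ˢ
      Icc (Y (T.b v)) (Y (T.t v)) : Set (ℝ × ℝ)))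
    rw [interior_rc, closure_prod_eq, closure_Ioo (g.lr' v).ne, closure_Ioo (g.bt' v).ne]
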